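/- For every n ∈ ℕ there exists C_n > 0 such that for every h > 0 and every mesh function u : ℝ_h → ℝ with ‖u‖_{L²_h} < ∞, and every integer m with 0 ≤ m < n, one has sup_{x ∈ ℝ_h} |D₊^m u(x)| ≤ C_n ( ‖u‖_{L²_h} + ‖D₊^n u‖_{L²_h} ). -/

import Mathlib

noncomputable section

/-- The forward difference operator with mesh size `h`, acting on mesh functions
(identified with functions `ℤ → ℝ` via `m ↦ u(mh)`). -/
def Dp (h : ℝ) (u : ℤ → ℝ) : ℤ → ℝ := fun m => (u (m + 1) - u m) / h

/-- The discrete `L²_h` norm `‖u‖_{L²_h} = √(Σ_m u(x_m)² h)`. -/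
def dnorm (h : ℝ) (u : ℤ → ℝ) : ℝ := Real.sqrt (∑' m : ℤ, u m ^ 2 * h)

lemma summable_sq_shift {h : ℝ} {v : ℤ → ℝ} (hv : Summable fun j => v j ^ 2 * h) :
    Summable fun j => v (j + 1) ^ 2 * h :=
  (Equiv.addRight (1 : ℤ)).summable_iff.mpr hv

lemma summable_sq_Dp {h : ℝ} (hh : 0 < h) {v : ℤ → ℝ} (hv : Summable fun j => v j ^ 2 * h) :
    Summable fun j => Dp h v j ^ 2 * h := by
  refine Summable.of_nonneg_of_le (fun j => by positivity) (fun j => ?_)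
    (((summable_sq_shift hv).add hv).mul_left (2 / h ^ 2))
  have e : Dp h v j ^ 2 * h = (v (j + 1) - v j) ^ 2 * (h / h ^ 2) := by
    simp only [Dp]; ring
  have e' : 2 / h ^ 2 * (v (j + 1) ^ 2 * h + v j ^ 2 * h)
      = 2 * (v (j + 1) ^ 2 + v j ^ 2) * (h / h ^ 2) := by ring
  rw [e, e']
  gcongr
  nlinarith [sq_nonneg (v (j + 1) + v j)]

lemma summable_sq_iterate_Dp {h : ℝ} (hh : 0 < h) {u : ℤ → ℝ}
    (hu : Summable fun j => u j ^ 2 * h) (k : ℕ) :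
    Summable fun j => (Dp h)^[k] u j ^ 2 * h := by
  induction k with
  | zero => exact hu
  | succ k ih =>
    simp only [Function.iterate_succ_apply']
    exact summable_sq_Dp hh ih

lemma summable_mul_of_summable_sq {h : ℝ} (hh : 0 < h) {v w : ℤ → ℝ}
    (hv : Summable fun j => v j ^ 2 * h) (hw : Summable fun j => w j ^ 2 * h) :
    Summable fun j => v j * w j := by
  refine Summable.of_norm_bounded ((hv.add hw).mul_left (1 / (2 * h))) (fun j => ?_)
  have e : 1 / (2 * h) * (v j ^ 2 * h + w j ^ 2 * h) = (v j ^ 2 + w j ^ 2) / 2 := by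
    field_simp
  rw [e, Real.norm_eq_abs, abs_le]
  constructor <;> nlinarith [sq_nonneg (v j + w j), sq_nonneg (v j - w j)]

/-- Summation by parts gives `‖D₊v‖² ≤ (‖v‖² + ‖D₊²v‖²) / 2`. -/
lemma two_mul_tsum_sq_Dp_le {h : ℝ} (hh : 0 < h) {v : ℤ → ℝ}
    (hv : Summable fun j => v j ^ 2 * h) :
    2 * ∑' j, Dp h v j ^ 2 * h ≤ ∑' j, v j ^ 2 * h + ∑' j, Dp h (Dp h v) j ^ 2 * h := by
  have h1 := summable_sq_Dp hh hv
  have h2 := summable_sq_Dp hh h1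
  have hg := summable_mul_of_summable_sq hh hv h1
  have hg' : Summable fun j => v (j + 1) * Dp h v (j + 1) :=
    (Equiv.addRight (1 : ℤ)).summable_iff.mpr hg
  have eg : ∑' j, v (j + 1) * Dp h v (j + 1) = ∑' j, v j * Dp h v j :=
    (Equiv.addRight (1 : ℤ)).tsum_eq fun j => v j * Dp h v j
  have ev : ∑' j, v (j + 1) ^ 2 * h = ∑' j, v j ^ 2 * h :=
    (Equiv.addRight (1 : ℤ)).tsum_eq fun j => v j ^ 2 * h
  have hv' := summable_sq_shift hv
  have key : ∑' j, 2 * (Dp h v j ^ 2 * h) ≤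
      ∑' j, ((v (j + 1) ^ 2 * h + Dp h (Dp h v) j ^ 2 * h) +
        2 * (v (j + 1) * Dp h v (j + 1) - v j * Dp h v j)) := by
    refine (h1.mul_left 2).tsum_le_tsum (fun j => ?_) ((hv'.add h2).add ((hg'.sub hg).mul_left 2))
    have a1 : v j = v (j + 1) - h * Dp h v j := by
      simp only [Dp]; field_simp; ring
    have a2 : Dp h v (j + 1) = Dp h v j + h * Dp h (Dp h v) j := by
      rw [show Dp h (Dp h v) j = (Dp h v (j + 1) - Dp h v j) / h from rfl]; field_simp; ring
    generalize Dp h (Dp h v) j = c at *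
    rw [a2, a1]
    generalize Dp h v j = b at *
    nlinarith [mul_nonneg hh.le (sq_nonneg (v (j + 1) + c))]
  rwa [tsum_mul_left, (hv'.add h2).tsum_add ((hg'.sub hg).mul_left 2), hv'.tsum_add h2,
    tsum_mul_left, hg'.tsum_sub hg, eg, ev, sub_self, mul_zero, add_zero] at key

lemma sq_le_tsum_sq_add_tsum_sq_Dp {h : ℝ} (hh : 0 < h) {v : ℤ → ℝ}
    (hv : Summable fun j => v j ^ 2 * h) (l : ℤ) :
    v l ^ 2 ≤ ∑' j, v j ^ 2 * h + ∑' j, Dp h v j ^ 2 * h := by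
  have h1 := summable_sq_Dp hh hv
  have hv' := summable_sq_shift hv
  have ev : ∑' j, v (j + 1) ^ 2 * h = ∑' j, v j ^ 2 * h :=
    (Equiv.addRight (1 : ℤ)).tsum_eq fun j => v j ^ 2 * h
  let G : ℤ → ℝ := fun j => (v (j + 1) ^ 2 * h + v j ^ 2 * h) / 2 + Dp h v j ^ 2 * h
  have hG : Summable G := ((hv'.add hv).div_const 2).add h1
  have eG : ∑' j, G j = ∑' j, v j ^ 2 * h + ∑' j, Dp h v j ^ 2 * h := by
    rw [((hv'.add hv).div_const 2).tsum_add h1, tsum_div_const, hv'.tsum_add hv, ev]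
    ring
  have step : ∀ j, v (j + 1) ^ 2 ≤ v j ^ 2 + G j := fun j => by
    have a1 : v (j + 1) = v j + h * Dp h v j := by
      simp only [Dp]; field_simp; ring
    simp only [G]
    generalize Dp h v j = b at *
    have a2 : v (j + 1) ^ 2 - v j ^ 2 = h * b * (v (j + 1) + v j) := by rw [a1]; ring
    nlinarith [mul_nonneg hh.le (sq_nonneg (b - (v (j + 1) + v j) / 2)),
      mul_nonneg hh.le (sq_nonneg (v (j + 1) - v j))]
  have inj : Function.Injective fun k : ℕ => l - 1 - (k : ℤ) := fun a b hab => by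
    simp only at hab; omega
  have fin : ∀ N : ℕ, v l ^ 2 ≤ v (l - N) ^ 2 + ∑ k ∈ Finset.range N, G (l - 1 - k) := by
    intro N
    induction N with
    | zero => simp
    | succ N ih =>
      have := step (l - 1 - N)
      rw [show l - 1 - (N : ℤ) + 1 = l - N by ring] at this
      rw [Finset.sum_range_succ, show l - ((N + 1 : ℕ) : ℤ) = l - 1 - N by push_cast; ring]
      linarith
  have bound : ∀ N : ℕ, v l ^ 2 ≤ v (l - N) ^ 2 + ∑' j, G j := fun N => by
    have hle := hG.sum_le_tsum ((Finset.range N).map ⟨_, inj⟩) fun j _ => by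
      simp only [G]; positivity
    rw [Finset.sum_map] at hle
    exact (fin N).trans (by gcongr; exact hle)
  have lim : Filter.Tendsto (fun N : ℕ => v (l - N) ^ 2) Filter.atTop (nhds 0) := by
    have hs : Summable fun j => v j ^ 2 := (summable_mul_right_iff hh.ne').mp hv
    have inj' : Function.Injective fun k : ℕ => l - (k : ℤ) := fun a b hab => by
      simp only at hab; omega
    exact (hs.comp_injective inj').tendsto_atTop_zero
  rw [← eG]
  simpa using ge_of_tendsto' (lim.add_const _) bound

lemma le_max_of_midpoint_convex {a : ℕ → ℝ} (ha : ∀ k, 2 * a (k + 1) ≤ a k + a (k + 2)) :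
    ∀ {n k : ℕ}, k ≤ n → a k ≤ max (a 0) (a n) := by
  have dec : ∀ n, a (n + 1) ≤ a n → a n ≤ a 0 := by
    intro n
    induction n with
    | zero => exact fun _ => le_rfl
    | succ n ih =>
      intro hn
      have hn' : a (n + 1) ≤ a n := by linarith [ha n]
      exact hn'.trans (ih hn')
  intro n
  induction n with
  | zero => intro k hk; simp [Nat.le_zero.mp hk]
  | succ n ih =>
    intro k hk
    rcases Nat.le_succ_iff.mp hk with hk | rfl
    · refine (ih hk).trans (max_le (le_max_left _ _) ?_)
      rcases le_total (a (n + 1)) (a n) with hn | hn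
      · exact (dec n hn).trans (le_max_left _ _)
      · exact hn.trans (le_max_right _ _)
    · exact le_max_right _ _

/-- discrete Sobolev inequality
`sup_x |D₊^m u(x)| ≤ C_n (‖u‖_{L²_h} + ‖D₊^n u‖_{L²_h})` for `0 ≤ m < n`,
with `C_n` independent of `h` and `u`. -/
theorem statement5 (n : ℕ) :
    ∃ C > (0 : ℝ), ∀ h : ℝ, 0 < h → ∀ u : ℤ → ℝ,
      Summable (fun m : ℤ => u m ^ 2 * h) →
      ∀ m : ℕ, m < n →
        ∀ l : ℤ, |(Dp h)^[m] u l| ≤ C * (dnorm h u + dnorm h ((Dp h)^[n] u)) := by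
  refine ⟨2, two_pos, fun h hh u hu m hm l => ?_⟩
  let a : ℕ → ℝ := fun k => ∑' j, (Dp h)^[k] u j ^ 2 * h
  have ha0 : ∀ k, 0 ≤ a k := fun k => tsum_nonneg fun j => by positivity
  have hconv : ∀ k, 2 * a (k + 1) ≤ a k + a (k + 2) := fun k => by
    simpa only [a, Function.iterate_succ_apply'] using
      two_mul_tsum_sq_Dp_le hh (summable_sq_iterate_Dp hh hu k)
  have hmax : max (a 0) (a n) ≤ a 0 + a n :=
    max_le (le_add_of_nonneg_right (ha0 n)) (le_add_of_nonneg_left (ha0 0))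
  have hm0 := (le_max_of_midpoint_convex hconv hm.le).trans hmax
  have hm1 := (le_max_of_midpoint_convex hconv (Nat.succ_le_of_lt hm)).trans hmax
  have hsup : (Dp h)^[m] u l ^ 2 ≤ a m + a (m + 1) := by
    simpa only [a, Function.iterate_succ_apply'] using
      sq_le_tsum_sq_add_tsum_sq_Dp hh (summable_sq_iterate_Dp hh hu m) l
  have e0 : dnorm h u = √(a 0) := rfl
  have en : dnorm h ((Dp h)^[n] u) = √(a n) := rfl
  rw [e0, en]
  refine abs_le_of_sq_le_sq ?_ (by positivity)
  nlinarith [Real.sq_sqrt (ha0 0), Real.sq_sqrt (ha0 n), ha0 0, ha0 n,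
    mul_nonneg (Real.sqrt_nonneg (a 0)) (Real.sqrt_nonneg (a n))]
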